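/- arXiv:1412.7537 — 4 statements merged into one kernel-verified Lean document; each statement's English description precedes it below -/
import Mathlib

section
/- If in addition α < 1, then for every k ∈ {1,…,N-1} (so that ν^k ≠ 1), the eigenvalue β_k = -1 + (1-α)ν^k + α ∑_{ℓ=0}^{N-1} b_ℓ ν^{kℓ} has strictly negative real part: Re(β_k) < 0. -/
/-- A complex number of norm one other than `1` has real part less than one. -/
theorem Complex.re_lt_one_of_norm_eq_one {z : ℂ} (hz : ‖z‖ = 1) (hz1 : z ≠ 1) : z.re < 1 := by
  refine lt_of_le_of_ne (hz ▸ Complex.re_le_norm z) fun hre => hz1 ?_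
  have hsq : z.re * z.re + z.im * z.im = 1 := by
    rw [← Complex.normSq_apply, Complex.normSq_eq_norm_sq, hz, one_pow]
  refine Complex.ext hre ?_
  rw [hre] at hsq
  simpa using hsq

/-- A convex combination of complex numbers of norm at most one has real part at most one. -/
theorem Complex.re_sum_ofReal_mul_le_one {ι : Type*} (s : Finset ι) (b : ι → ℝ) (z : ι → ℂ)
    (hb : ∀ i ∈ s, 0 ≤ b i) (hsum : ∑ i ∈ s, b i = 1) (hz : ∀ i ∈ s, ‖z i‖ ≤ 1) :
    (∑ i ∈ s, (b i : ℂ) * z i).re ≤ 1 := by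
  rw [Complex.re_sum, ← hsum]
  refine Finset.sum_le_sum fun i hi => ?_
  rw [Complex.re_ofReal_mul]
  exact mul_le_of_le_one_right (hb i hi) ((Complex.re_le_norm _).trans (hz i hi))

/-- If `α < 1`, then for every `k ∈ {1,…,N-1}` the eigenvalue
`β_k = -1 + (1-α)ν^k + α ∑_ℓ b_ℓ ν^(kℓ)` has strictly negative real part. -/
theorem stmt_4 (N : ℕ) [NeZero N] (hN : 2 ≤ N)
    (b : ZMod N → ℝ) (hb : ∀ ℓ, 0 ≤ b ℓ) (hbsum : ∑ ℓ : ZMod N, b ℓ = 1)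
    (α : ℝ) (hα : α ∈ Set.Ico (0 : ℝ) 1)
    (ν : ℂ) (hν : ν = Complex.exp (2 * Real.pi * Complex.I / N))
    (k : ℕ) (hk1 : 1 ≤ k) (hk : k < N) :
    (-1 + (1 - (α : ℂ)) * ν ^ k
      + (α : ℂ) * ∑ ℓ : ZMod N, (b ℓ : ℂ) * ν ^ (k * ℓ.val)).re < 0 := by
  have hprim : IsPrimitiveRoot ν N := hν ▸ Complex.isPrimitiveRoot_exp N (NeZero.ne N)
  have hnorm : ‖ν‖ = 1 := hprim.norm'_eq_one (NeZero.ne N)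
  have hre : (ν ^ k).re < 1 :=
    Complex.re_lt_one_of_norm_eq_one (by rw [norm_pow, hnorm, one_pow])
      (hprim.pow_ne_one_of_pos_of_lt (by lia) hk)
  have hsum : (∑ ℓ : ZMod N, (b ℓ : ℂ) * ν ^ (k * ℓ.val)).re ≤ 1 :=
    Complex.re_sum_ofReal_mul_le_one _ b _ (fun ℓ _ => hb ℓ) hbsum fun ℓ _ => by
      rw [norm_pow, hnorm, one_pow]
  rw [← Complex.ofReal_one, ← Complex.ofReal_sub, Complex.add_re, Complex.add_re,
    Complex.re_ofReal_mul, Complex.re_ofReal_mul, Complex.neg_re, Complex.ofReal_re]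
  nlinarith [mul_pos (sub_pos.2 hα.2) (sub_pos.2 hre),
    mul_nonneg hα.1 (sub_nonneg.2 hsum)]
end

section
/- Suppose that for some k ∈ {1,…,N-1} with β_k ≠ 0 there exist ω₀ ∈ ℝ with ω₀ ≠ 0, C > 0 and τ ≥ 0 such that -iω₀ + Cβ_k e^{-iτω₀} = 0, where β_k = -1 + (1-α)ν^k + α ∑_{ℓ=0}^{N-1} b_ℓ ν^{kℓ}. Then τ ≥ 1/(2C). (In particular, the critical delay τ* of the relaxed follow-the-leader model satisfies τ* ≥ 1/(2C).) -/
/-- A convex combination of complex numbers of norm at most one has norm at most one. -/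
theorem norm_sum_ofReal_mul_le_one {ι : Type*} [Fintype ι] {b : ι → ℝ} (hb : ∀ i, 0 ≤ b i)
    (hbsum : ∑ i, b i = 1) {z : ι → ℂ} (hz : ∀ i, ‖z i‖ ≤ 1) :
    ‖∑ i, (b i : ℂ) * z i‖ ≤ 1 := by
  refine (norm_sum_le _ _).trans (hbsum ▸ Finset.sum_le_sum fun i _ => ?_)
  rw [norm_mul, Complex.norm_real, Real.norm_of_nonneg (hb i)]
  exact mul_le_of_le_one_right (hb i) (hz i)

/-- If `β` lies in the closed unit disc around `-1` and `λ = C β e^{-τλ}` has a nonzero purely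
imaginary root, then `τ ≥ 1 / (2C)`. -/
theorem one_div_le_delay_of_imaginary_root {β : ℂ} (hβ : ‖β + 1‖ ≤ 1) {C τ ω : ℝ} (hC : 0 < C)
    (hτ : 0 ≤ τ) (hω : ω ≠ 0)
    (h : -(Complex.I * (ω : ℂ)) + (C : ℂ) * β * Complex.exp (-(Complex.I * (τ : ℂ) * (ω : ℂ))) = 0) :
    1 / (2 * C) ≤ τ := by
  have hrot : (C : ℂ) * β = Complex.I * ω * Complex.exp ((τ * ω : ℝ) * Complex.I) := by
    have hexp : Complex.exp (-(Complex.I * (τ : ℂ) * (ω : ℂ))) *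
        Complex.exp ((τ * ω : ℝ) * Complex.I) = 1 := by
      rw [← Complex.exp_add, Complex.exp_eq_one_iff]
      exact ⟨0, by push_cast; ring⟩
    linear_combination Complex.exp ((τ * ω : ℝ) * Complex.I) * h - (C : ℂ) * β * hexp
  have hre : C * β.re = -(ω * Real.sin (τ * ω)) := by
    simpa [Complex.exp_ofReal_mul_I_re, Complex.exp_ofReal_mul_I_im, -Complex.ofReal_mul] using
      congrArg Complex.re hrot
  have him : C * β.im = ω * Real.cos (τ * ω) := by
    simpa [Complex.exp_ofReal_mul_I_re, Complex.exp_ofReal_mul_I_im, -Complex.ofReal_mul] using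
      congrArg Complex.im hrot
  have hdisc : (β.re + 1) ^ 2 + β.im ^ 2 ≤ 1 := by
    have := pow_le_one₀ (n := 2) (norm_nonneg _) hβ
    rw [Complex.sq_norm, Complex.normSq_apply] at this
    simp only [Complex.add_re, Complex.one_re, Complex.add_im, Complex.one_im, add_zero] at this
    linarith
  have hsq : ω ^ 2 ≤ 2 * C * (ω * Real.sin (τ * ω)) := by
    have hscaled := mul_le_mul_of_nonneg_left hdisc (sq_nonneg C)
    have hcircle : (C * β.re) ^ 2 + (C * β.im) ^ 2 = ω ^ 2 := by
      rw [hre, him]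
      linear_combination ω ^ 2 * Real.sin_sq_add_cos_sq (τ * ω)
    linear_combination hscaled - hcircle - 2 * C * hre
  have hsin : ω * Real.sin (τ * ω) ≤ τ * ω ^ 2 := by
    calc ω * Real.sin (τ * ω) ≤ |ω| * |Real.sin (τ * ω)| := (le_abs_self _).trans (abs_mul _ _).le
      _ ≤ |ω| * |τ * ω| := mul_le_mul_of_nonneg_left Real.abs_sin_le_abs (abs_nonneg _)
      _ = τ * ω ^ 2 := by
        rw [abs_mul, abs_of_nonneg hτ, ← sq_abs ω]
        ring
  have hωpos : 0 < ω ^ 2 := by positivity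
  rw [div_le_iff₀ (by positivity)]
  refine le_of_mul_le_mul_right ?_ hωpos
  linear_combination hsq + 2 * C * hsin


/-- If for some `k ∈ {1,…,N-1}` with `β_k ≠ 0` there exist `ω₀ ≠ 0`, `C > 0` and `τ ≥ 0`
such that `-iω₀ + C β_k e^{-iτω₀} = 0`, where
`β_k = -1 + (1-α)ν^k + α ∑_ℓ b_ℓ ν^(kℓ)`, then `τ ≥ 1/(2C)`. -/
theorem stmt_7 (N : ℕ) [NeZero N] (hN : 2 ≤ N)
    (b : ZMod N → ℝ) (hb : ∀ ℓ, 0 ≤ b ℓ) (hbsum : ∑ ℓ : ZMod N, b ℓ = 1)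
    (α : ℝ) (hα : α ∈ Set.Icc (0 : ℝ) 1)
    (ν : ℂ) (hν : ν = Complex.exp (2 * Real.pi * Complex.I / N))
    (k : ℕ) (hk1 : 1 ≤ k) (hk : k < N)
    (β : ℂ)
    (hβ : β = -1 + (1 - (α : ℂ)) * ν ^ k
        + (α : ℂ) * ∑ ℓ : ZMod N, (b ℓ : ℂ) * ν ^ (k * ℓ.val))
    (hβ0 : β ≠ 0)
    (C τ ω₀ : ℝ) (hC : 0 < C) (hτ : 0 ≤ τ) (hω : ω₀ ≠ 0)
    (h : -(Complex.I * (ω₀ : ℂ)) + (C : ℂ) * β * Complex.exp (-(Complex.I * (τ : ℂ) * (ω₀ : ℂ))) = 0) :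
    1 / (2 * C) ≤ τ := by
  have hνnorm : ‖ν‖ = 1 := by
    have harg : (2 * Real.pi * Complex.I / N : ℂ) = (2 * Real.pi / N : ℝ) * Complex.I := by
      push_cast
      ring
    rw [hν, harg, Complex.norm_exp_ofReal_mul_I]
  refine one_div_le_delay_of_imaginary_root ?_ hC hτ hω h
  have hsum : ‖∑ ℓ : ZMod N, (b ℓ : ℂ) * ν ^ (k * ℓ.val)‖ ≤ 1 :=
    norm_sum_ofReal_mul_le_one hb hbsum fun ℓ => by simp [hνnorm]
  have hβ1 : β + 1 = ((1 - α : ℝ) : ℂ) * ν ^ k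
      + (α : ℂ) * ∑ ℓ : ZMod N, (b ℓ : ℂ) * ν ^ (k * ℓ.val) := by
    rw [hβ]
    push_cast
    ring
  calc ‖β + 1‖ ≤ ‖((1 - α : ℝ) : ℂ) * ν ^ k‖
        + ‖(α : ℂ) * ∑ ℓ : ZMod N, (b ℓ : ℂ) * ν ^ (k * ℓ.val)‖ := hβ1 ▸ norm_add_le _ _
    _ = (1 - α) + α * ‖∑ ℓ : ZMod N, (b ℓ : ℂ) * ν ^ (k * ℓ.val)‖ := by
      rw [norm_mul, norm_mul, Complex.norm_real, Complex.norm_real, norm_pow, hνnorm, one_pow,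
        mul_one, Real.norm_of_nonneg (sub_nonneg.2 hα.2), Real.norm_of_nonneg hα.1]
    _ ≤ 1 := by linarith [mul_le_of_le_one_right hα.1 hsum]
end

section
/- Assume b_ℓ = 1/N for all ℓ and α ∈ [0,1). Suppose that for some k ∈ {1,…,N-1} (so that ν^k ≠ 1, and hence β_k = -1 + (1-α)ν^k ≠ 0) there exist ω₀ ∈ ℝ with ω₀ ≠ 0, C > 0 and τ ≥ 0 such that -iω₀ + Cβ_k e^{-iτω₀} = 0. Then τ ≥ max(1, arccos(1-α))/((2-α)C). (In particular the critical delay τ* satisfies τ* ≥ max(1, arccos(1-α))/((2-α)C).) -/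
/-- If `ω > 0` solves the real and imaginary parts of the characteristic equation for the
eigenvalue `-1 + r (x + i y)` with `x ^ 2 + y ^ 2 = 1`, then the delay `τ` is bounded below. -/
theorem delay_lower_bound_of_pos {r x y C τ ω : ℝ} (hr0 : 0 < r) (hr1 : r ≤ 1)
    (hxy : x ^ 2 + y ^ 2 = 1) (hC : 0 < C) (hτ : 0 ≤ τ) (hω : 0 < ω)
    (hsin : C * (1 - r * x) = ω * Real.sin (τ * ω))
    (hcos : C * (r * y) = ω * Real.cos (τ * ω)) :
    max 1 (Real.arccos r) / ((1 + r) * C) ≤ τ := by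
  have hsq : ω ^ 2 = C ^ 2 * (1 - 2 * r * x + r ^ 2) := by
    have h := Real.sin_sq_add_cos_sq (τ * ω)
    calc ω ^ 2 = (ω * Real.sin (τ * ω)) ^ 2 + (ω * Real.cos (τ * ω)) ^ 2 := by
          linear_combination -(ω ^ 2) * h
      _ = C ^ 2 * (1 - 2 * r * x + r ^ 2) := by
          rw [← hsin, ← hcos]
          linear_combination C ^ 2 * r ^ 2 * hxy
  have hx : -1 ≤ x := by nlinarith [sq_nonneg y]
  have hωle : ω ≤ (1 + r) * C := by
    refine le_of_sq_le_sq ?_ (by positivity)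
    rw [hsq]
    nlinarith [mul_nonneg (mul_nonneg (sq_nonneg C) hr0.le) (by linarith : 0 ≤ 1 + x)]
  rw [div_le_iff₀ (by positivity)]
  refine max_le ?_ ?_
  · have hle : C * (1 - r * x) ≤ ω ^ 2 * τ := by
      rw [hsin]
      nlinarith [mul_le_mul_of_nonneg_left (Real.sin_le (by positivity : 0 ≤ τ * ω)) hω.le]
    have hgeom : 1 - 2 * r * x + r ^ 2 ≤ (1 - r * x) * (1 + r) := by
      nlinarith [mul_nonneg (mul_nonneg hr0.le (by linarith : 0 ≤ 1 + x)) (sub_nonneg.2 hr1)]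
    have hkey : ω ^ 2 * 1 ≤ ω ^ 2 * (τ * ((1 + r) * C)) := by
      calc ω ^ 2 * 1 = C ^ 2 * (1 - 2 * r * x + r ^ 2) := by rw [mul_one, hsq]
        _ ≤ C ^ 2 * ((1 - r * x) * (1 + r)) := by gcongr
        _ = C * (1 - r * x) * ((1 + r) * C) := by ring
        _ ≤ ω ^ 2 * τ * ((1 + r) * C) := by gcongr
        _ = ω ^ 2 * (τ * ((1 + r) * C)) := by ring
    exact le_of_mul_le_mul_left hkey (by positivity)
  · refine le_trans ?_ (mul_le_mul_of_nonneg_left hωle hτ)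
    by_contra! hlt
    have hr : r < Real.cos (τ * ω) := by
      have h := Real.cos_lt_cos_of_nonneg_of_le_pi (by positivity) (Real.arccos_le_pi r) hlt
      rwa [Real.cos_arccos (by linarith) hr1] at h
    have hy : ω < C * y := by
      have h := mul_lt_mul_of_pos_left hr hω
      rw [← hcos] at h
      exact lt_of_mul_lt_mul_left (by linarith : r * ω < r * (C * y)) hr0.le
    have hsqlt : ω ^ 2 < (C * y) ^ 2 := by gcongr
    have hsplit : ω ^ 2 = (C * y) ^ 2 + (C * (r - x)) ^ 2 := by
      linear_combination hsq - C ^ 2 * hxy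
    nlinarith [sq_nonneg (C * (r - x))]


/-- Uniform weights `b_ℓ = 1/N`, `α ∈ [0,1)`. If for some `k ∈ {1,…,N-1}` there exist
`ω₀ ≠ 0`, `C > 0` and `τ ≥ 0` such that `-iω₀ + Cβ_k e^{-iτω₀} = 0` with
`β_k = -1 + (1-α)ν^k`, then `τ ≥ max(1, arccos(1-α))/((2-α)C)`. -/
theorem stmt_13 (N : ℕ) [NeZero N] (hN : 2 ≤ N)
    (α : ℝ) (hα : α ∈ Set.Ico (0 : ℝ) 1)
    (ν : ℂ) (hν : ν = Complex.exp (2 * Real.pi * Complex.I / N))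
    (k : ℕ) (hk1 : 1 ≤ k) (hk : k < N)
    (β : ℂ) (hβ : β = -1 + (1 - (α : ℂ)) * ν ^ k)
    (C τ ω₀ : ℝ) (hC : 0 < C) (hτ : 0 ≤ τ) (hω : ω₀ ≠ 0)
    (h : -(Complex.I * (ω₀ : ℂ)) + (C : ℂ) * β * Complex.exp (-(Complex.I * (τ : ℂ) * (ω₀ : ℂ))) = 0) :
    max 1 (Real.arccos (1 - α)) / ((2 - α) * C) ≤ τ := by
  have hnorm : ‖ν ^ k‖ = 1 := by
    have h1 : ν = Complex.exp ((2 * Real.pi / N : ℝ) * Complex.I) := by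
      rw [hν]
      congr 1
      push_cast
      ring
    rw [norm_pow, h1, Complex.norm_exp_ofReal_mul_I, one_pow]
  obtain ⟨hα0, hα1⟩ := hα
  have hxy : (ν ^ k).re ^ 2 + (ν ^ k).im ^ 2 = 1 := by
    have h1 := Complex.sq_norm (ν ^ k)
    rw [hnorm, Complex.normSq_apply] at h1
    linarith
  have hexp : Complex.exp (-(Complex.I * (τ : ℂ) * (ω₀ : ℂ))) *
      Complex.exp ((τ * ω₀ : ℝ) * Complex.I) = 1 := by
    rw [← Complex.exp_add, ← Complex.exp_zero]
    congr 1
    push_cast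
    ring
  have hmain : (C : ℂ) * (-1 + ((1 - α : ℝ) : ℂ) * ν ^ k) =
      Complex.I * ω₀ * (Real.cos (τ * ω₀) + Real.sin (τ * ω₀) * Complex.I) := by
    rw [Complex.ofReal_cos, Complex.ofReal_sin, ← Complex.exp_mul_I, Complex.ofReal_sub,
      Complex.ofReal_one, ← hβ]
    linear_combination Complex.exp ((τ * ω₀ : ℝ) * Complex.I) * h - C * β * hexp
  generalize ν ^ k = z at hxy hmain
  have hre := congrArg Complex.re hmain
  have him := congrArg Complex.im hmain
  simp only [Complex.mul_re, Complex.mul_im, Complex.add_re, Complex.add_im, Complex.neg_re,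
    Complex.neg_im, Complex.one_re, Complex.one_im, Complex.ofReal_re, Complex.ofReal_im,
    Complex.I_re, Complex.I_im] at hre him
  rw [show 2 - α = 1 + (1 - α) by ring]
  rcases lt_or_gt_of_ne hω with hneg | hpos
  · refine delay_lower_bound_of_pos (x := z.re) (y := -z.im) (ω := -ω₀) (by linarith)
      (by linarith) (by rwa [neg_sq]) hC hτ (by linarith) ?_ ?_
    · rw [mul_neg, Real.sin_neg]
      linarith
    · rw [mul_neg τ, Real.cos_neg]
      linarith
  · exact delay_lower_bound_of_pos (x := z.re) (y := z.im) (by linarith) (by linarith) hxy hC hτ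
      hpos (by linarith) (by linarith)
end

section
/- Let α ∈ [0,1] and C > 0, and set τ = π/(2C(2-α)) and ω₀ = C(2-α). Then ω₀ ≠ 0 and -iω₀ + C·(-(2-α))·e^{-iτω₀} = 0. (Hence when -(2-α) is an eigenvalue of the system matrix, the critical delay satisfies τ* ≤ π/(2(2-α)C).) -/
/-- For `α ∈ [0,1]` and `C > 0`, setting `τ = π/(2C(2-α))` and `ω₀ = C(2-α)` yields
`ω₀ ≠ 0` and a nonzero purely imaginary characteristic root:
`-iω₀ + C·(-(2-α))·e^{-iτω₀} = 0`. -/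
theorem stmt_14 (α : ℝ) (hα : α ∈ Set.Icc (0 : ℝ) 1) (C : ℝ) (hC : 0 < C)
    (τ ω₀ : ℝ) (hτ : τ = Real.pi / (2 * C * (2 - α))) (hω₀ : ω₀ = C * (2 - α)) :
    ω₀ ≠ 0 ∧
      -(Complex.I * (ω₀ : ℂ))
        + (C : ℂ) * (-((2 : ℂ) - (α : ℂ)))
          * Complex.exp (-(Complex.I * (τ : ℂ) * (ω₀ : ℂ))) = 0 := by
  have h2 : 0 < 2 - α := by linarith [hα.2]
  have hpos : 0 < ω₀ := hω₀ ▸ mul_pos hC h2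
  refine ⟨hpos.ne', ?_⟩
  have hprod : τ * ω₀ = Real.pi / 2 := by
    rw [hτ, hω₀]
    field_simp
  have hprodC : (τ : ℂ) * (ω₀ : ℂ) = (Real.pi : ℂ) / 2 := by
    exact_mod_cast congrArg (fun x : ℝ => (x : ℂ)) hprod
  have hexp : Complex.exp (-(Complex.I * (τ : ℂ) * (ω₀ : ℂ))) = -Complex.I := by
    rw [mul_assoc, hprodC, mul_comm, Complex.exp_neg, Complex.exp_pi_div_two_mul_I,
      Complex.inv_I]
  rw [hexp, hω₀]
  push_cast
  ring
end
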